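/- Let A be a finite nonempty type, r : A → ℝ, q : A → ℝ a probability vector (the old policy), z : A → ℝ logits, π_z the softmax policy, H the entropy, J(z) = ∑_a π_z(a) · r(a), and A_z(a) = r(a) - J(z). For η, β ∈ ℝ, define the KL-Cov update direction Δ(a) = η · π_z(a) · A_z(a) - η·β · (π_z(a) - q(a)). Then the Fréchet derivative of H at z applied to Δ equals -η · Cov_{π_z}(a ↦ log π_z(a), a ↦ π_z(a) · A_z(a)) + η·β · Cov_{π_z}(a ↦ log π_z(a), a ↦ π_z(a) - q(a)). -/

import Mathlib

/-- Softmax policy induced by logits `z`. -/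
noncomputable def softmax {A : Type*} [Fintype A] (z : A → ℝ) (a : A) : ℝ :=
  Real.exp (z a) / ∑ a', Real.exp (z a')

/-- Shannon entropy of the softmax policy. -/
noncomputable def entropy {A : Type*} [Fintype A] (z : A → ℝ) : ℝ :=
  -∑ a, softmax z a * Real.log (softmax z a)

/-- Expected reward of the softmax policy. -/
noncomputable def expReward {A : Type*} [Fintype A] (r : A → ℝ) (z : A → ℝ) : ℝ :=
  ∑ a, softmax z a * r a

/-- Advantage of action `a` under the softmax policy with logits `z`. -/
noncomputable def advantage {A : Type*} [Fintype A] (r : A → ℝ) (z : A → ℝ) (a : A) : ℝ :=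
  r a - expReward r z

/-- Covariance of `f` and `g` under the probability vector `p`. -/
noncomputable def cov {A : Type*} [Fintype A] (p f g : A → ℝ) : ℝ :=
  ∑ a, p a * (f a - ∑ a', p a' * f a') * (g a - ∑ a', p a' * g a')

/-- A probability vector on a finite type. -/
def IsProbVec {A : Type*} [Fintype A] (p : A → ℝ) : Prop :=
  (∀ a, 0 ≤ p a) ∧ ∑ a, p a = 1

theorem sum_exp_pos {A : Type*} [Fintype A] [Nonempty A] (z : A → ℝ) :
    0 < ∑ a, Real.exp (z a) :=
  Finset.sum_pos (fun _ _ => Real.exp_pos _) Finset.univ_nonempty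

theorem sum_softmax {A : Type*} [Fintype A] [Nonempty A] (z : A → ℝ) :
    ∑ a, softmax z a = 1 := by
  simp only [softmax, ← Finset.sum_div]
  exact div_self (sum_exp_pos z).ne'

theorem log_softmax {A : Type*} [Fintype A] [Nonempty A] (z : A → ℝ) (a : A) :
    Real.log (softmax z a) = z a - Real.log (∑ a', Real.exp (z a')) := by
  rw [softmax, Real.log_div (Real.exp_pos _).ne' (sum_exp_pos z).ne', Real.log_exp]

theorem entropy_eq {A : Type*} [Fintype A] [Nonempty A] (z : A → ℝ) :
    entropy z = Real.log (∑ a, Real.exp (z a)) -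
      (∑ a, Real.exp (z a) * z a) / ∑ a, Real.exp (z a) := by
  have h : ∑ a, softmax z a * z a =
      (∑ a, Real.exp (z a) * z a) / ∑ a, Real.exp (z a) := by
    simp only [softmax, Finset.sum_div, div_mul_eq_mul_div]
  simp only [entropy, log_softmax, mul_sub, Finset.sum_sub_distrib, ← Finset.sum_mul,
    sum_softmax, h]
  ring

theorem cov_eq_sub {A : Type*} [Fintype A] {p : A → ℝ} (hp : ∑ a, p a = 1) (f g : A → ℝ) :
    cov p f g = ∑ a, p a * f a * g a - (∑ a, p a * f a) * ∑ a, p a * g a := by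
  unfold cov
  set m := ∑ a, p a * f a with hm
  set n := ∑ a, p a * g a with hn
  have h : ∀ a, p a * (f a - m) * (g a - n) =
      p a * f a * g a - p a * f a * n - m * (p a * g a) + p a * (m * n) := fun a => by ring
  simp only [h, Finset.sum_add_distrib, Finset.sum_sub_distrib, ← Finset.sum_mul,
    ← Finset.mul_sum, hp, ← hm, ← hn]
  ring

theorem cov_sub_const_left {A : Type*} [Fintype A] {p : A → ℝ} (hp : ∑ a, p a = 1)
    (f g : A → ℝ) (c : ℝ) : cov p (fun a => f a - c) g = cov p f g := by
  simp only [cov, mul_sub (p _) (f _) c, Finset.sum_sub_distrib, ← Finset.sum_mul, hp, one_mul,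
    sub_sub_sub_cancel_right]

theorem cov_linear_right {A : Type*} [Fintype A] (p f g h : A → ℝ) (c d : ℝ) :
    cov p f (fun a => c * g a - d * h a) = c * cov p f g - d * cov p f h := by
  have hE : ∑ a, p a * (c * g a - d * h a) = c * ∑ a, p a * g a - d * ∑ a, p a * h a := by
    rw [Finset.mul_sum, Finset.mul_sum, ← Finset.sum_sub_distrib]
    exact Finset.sum_congr rfl fun a _ => by ring
  unfold cov
  rw [hE]
  generalize ∑ a, p a * f a = F
  generalize ∑ a, p a * g a = G
  generalize ∑ a, p a * h a = K
  rw [Finset.mul_sum, Finset.mul_sum, ← Finset.sum_sub_distrib]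
  exact Finset.sum_congr rfl fun a _ => by ring

/-- The derivative of the entropy in direction `d` is `-Cov(log π_z, d)`. -/
theorem fderiv_entropy_apply {A : Type*} [Fintype A] [Nonempty A] (z d : A → ℝ) :
    fderiv ℝ entropy z d = -cov (softmax z) (fun a => Real.log (softmax z a)) d := by
  have hS := (sum_exp_pos z).ne'
  have hproj : ∀ a, HasFDerivAt (fun y : A → ℝ => y a)
      (ContinuousLinearMap.proj (R := ℝ) (φ := fun _ : A => ℝ) a) z := fun a =>
    hasFDerivAt_apply a z
  have hsum := HasFDerivAt.fun_sum (u := Finset.univ) fun a _ => (hproj a).exp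
  have hnum := HasFDerivAt.fun_sum (u := Finset.univ) fun a _ => (hproj a).exp.mul (hproj a)
  have hH := (hsum.log hS).sub (hnum.mul ((hasDerivAt_inv hS).comp_hasFDerivAt z hsum))
  rw [(hH.congr_of_eventuallyEq (Filter.Eventually.of_forall entropy_eq)).fderiv]
  simp only [log_softmax]
  rw [cov_sub_const_left (sum_softmax z), cov_eq_sub (sum_softmax z)]
  simp only [softmax, div_mul_eq_mul_div, ← Finset.sum_div]
  have hcomm : ∑ a, z a * (Real.exp (z a) * d a) = ∑ a, Real.exp (z a) * z a * d a :=
    Finset.sum_congr rfl fun a _ => by ring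
  simp [Finset.sum_add_distrib, hcomm]
  ring

/-- Entropy dynamics under KL-Cov: the Fréchet derivative of the entropy at `z` applied
to the KL-Cov update direction `Δ(a) = η·π_z(a)·A_z(a) - η·β·(π_z(a) - q(a))` equals
`-η·Cov(log π_z, π_z·A_z) + η·β·Cov(log π_z, π_z - q)`. -/
theorem entropy_dynamics_klCov {A : Type*} [Fintype A] [Nonempty A]
    (r : A → ℝ) (q : A → ℝ) (hq : IsProbVec q) (z : A → ℝ) (η β : ℝ) :
    fderiv ℝ entropy z
        (fun a => η * (softmax z a * advantage r z a) - η * β * (softmax z a - q a)) =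
      -(η * cov (softmax z) (fun a => Real.log (softmax z a))
          (fun a => softmax z a * advantage r z a)) +
        η * β * cov (softmax z) (fun a => Real.log (softmax z a))
          (fun a => softmax z a - q a) := by
  rw [fderiv_entropy_apply, cov_linear_right]
  ring
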